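/- Let f satisfy Condition (A), let u : Ω → [0, M] be concave and upper semicontinuous, and let x₀ ∈ ∂Ω satisfy Condition (B), with supporting line l and outward unit normal n. Assume z₀ := u(x₀) = max{u(x) : x ∈ l ∩ ∂Ω} > 0. Then there exists a family of convex bodies Ω̃_k ⊆ Ω_k, defined for all sufficiently large k > 0, such that: (i) (1/k)·sup{|∇u(x)| : x ∈ Ω̃_k, u differentiable at x} → 0 as k → +∞, and (ii) there is a constant c > 0 such that for all sufficiently large k and all differentiability points x ∈ Ω̃_k, (|Ω̃_k|/|Ω_k|) · k/(1 + |∇u(x)|) ≥ c. -/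

import Mathlib

noncomputable section

open MeasureTheory Set Filter
open scoped RealInnerProductSpace Topology

/-- The Euclidean plane. -/
abbrev E2 : Type := EuclideanSpace ℝ (Fin 2)

/-- A convex body in the plane: a compact convex set with nonempty interior. -/
def IsConvexBody (Ω : Set E2) : Prop :=
  IsCompact Ω ∧ Convex ℝ Ω ∧ (interior Ω).Nonempty

/-- Condition (A): `(1+|x|)f(x)/(|y|f(y)) → +∞` as `(1+|x|)/|y| → 0`. -/
def CondA (f : E2 → ℝ) : Prop :=
  ∀ N : ℝ, 0 < N → ∃ δ : ℝ, 0 < δ ∧ ∀ x y : E2,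
    1 + ‖x‖ < δ * ‖y‖ → N < ((1 + ‖x‖) * f x) / (‖y‖ * f y)

/-- `n` is an outward unit normal of a supporting line of `Ω` at `p`. -/
def IsSupportNormal (Ω : Set E2) (p n : E2) : Prop :=
  ‖n‖ = 1 ∧ ∀ x ∈ Ω, 0 ≤ ⟪p - x, n⟫

/-- A boundary point is regular if the supporting line (equivalently, the outward
unit normal) at it is unique. -/
def RegularPt (Ω : Set E2) (p : E2) : Prop :=
  ∃! n : E2, IsSupportNormal Ω p n

/-- The truncated function `u^(k)(x) = min{u(x), k⟨x₀ − x, n⟩}`. -/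
def trunc (u : E2 → ℝ) (x₀ n : E2) (k : ℝ) : E2 → ℝ :=
  fun x => min (u x) (k * ⟪x₀ - x, n⟫)

/-- The set `Ω_k = {x ∈ Ω : u(x) ≥ k⟨x₀ − x, n⟩}`. -/
def Omk (Ω : Set E2) (u : E2 → ℝ) (x₀ n : E2) (k : ℝ) : Set E2 :=
  {x ∈ Ω | k * ⟪x₀ - x, n⟫ ≤ u x}

/-- Condition (B) at `x₀`: `x₀` is a regular boundary point, and the endpoints
(extreme points) of the segment `l ∩ ∂Ω` are regular as well. -/
def CondB (Ω : Set E2) (x₀ : E2) : Prop :=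
  RegularPt Ω x₀ ∧
  ∀ n : E2, IsSupportNormal Ω x₀ n →
    ∀ y ∈ ({x : E2 | ⟪x₀ - x, n⟫ = 0} ∩ frontier Ω).extremePoints ℝ,
      RegularPt Ω y

/-- Height above the supporting line, evaluated on a homothetic image. -/
theorem height_homothety (o n c y : E2) (r : ℝ) :
    ⟪o - AffineMap.homothety c r y, n⟫ = (1 - r) * ⟪o - c, n⟫ + r * ⟪o - y, n⟫ := by
  have : o - AffineMap.homothety c r y = (1 - r) • (o - c) + r • (o - y) := by
    rw [AffineMap.homothety_apply]
    simp only [vsub_eq_sub, vadd_eq_add]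
    module
  rw [this, inner_add_left, real_inner_smul_left, real_inner_smul_left]

theorem homothety_mem {Ω : Set E2} (hc : Convex ℝ Ω) {c y : E2} (hcΩ : c ∈ Ω) (hy : y ∈ Ω)
    {r : ℝ} (h0 : 0 ≤ r) (h1 : r ≤ 1) : AffineMap.homothety c r y ∈ Ω := by
  rw [AffineMap.homothety_eq_lineMap]
  exact hc.lineMap_mem hcΩ hy ⟨h0, h1⟩

theorem volume_homothety (c : E2) (r : ℝ) (s : Set E2) :
    volume (AffineMap.homothety c r '' s) = ENNReal.ofReal (r ^ 2) * volume s := by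
  rw [Measure.addHaar_image_homothety]
  simp

/-- The strip of `Ω` of height at most `a`. -/
def strip (Ω : Set E2) (o n : E2) (a : ℝ) : Set E2 := {y ∈ Ω | ⟪o - y, n⟫ ≤ a}

theorem strip_compact {Ω : Set E2} (hΩ : IsCompact Ω) (o n : E2) (a : ℝ) :
    IsCompact (strip Ω o n a) := by
  apply hΩ.inter_right (t := {y | ⟪o - y, n⟫ ≤ a})
  exact isClosed_le (by fun_prop) (by fun_prop)

theorem strip_convex {Ω : Set E2} (hΩ : Convex ℝ Ω) (o n : E2) (a : ℝ) :
    Convex ℝ (strip Ω o n a) := by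
  intro x hx y hy s t hs ht hst
  refine ⟨hΩ hx.1 hy.1 hs ht hst, ?_⟩
  have : o - (s • x + t • y) = s • (o - x) + t • (o - y) := by
    have : s = 1 - t := by linarith
    subst this
    module
  rw [this, inner_add_left, real_inner_smul_left, real_inner_smul_left]
  have h1 := mul_le_mul_of_nonneg_left hx.2 hs
  have h2 := mul_le_mul_of_nonneg_left hy.2 ht
  have : s * a + t * a = a := by rw [← add_mul, hst, one_mul]
  linarith

/-- The area of strips grows at least linearly. -/
theorem strip_growth {Ω : Set E2} (hcomp : IsCompact Ω) (hconv : Convex ℝ Ω) {o n p : E2}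
    (hsup : ∀ x ∈ Ω, 0 ≤ ⟪o - x, n⟫) (hp : p ∈ Ω) {a τ : ℝ} (ha : 0 < a) (haτ : 4 * a ≤ τ)
    (hτ : τ ≤ ⟪o - p, n⟫ / 2) :
    τ / (8 * a) * (volume (strip Ω o n a)).toReal ≤ (volume (strip Ω o n τ)).toReal := by
  set h := ⟪o - p, n⟫ with hh
  have hh0 : 0 < h := by linarith
  obtain ⟨N, hN1, hN2⟩ : ∃ N : ℕ, ((N : ℝ) + 1) * a ≤ τ ∧ τ / (2 * a) ≤ N := by
    have hr : 4 ≤ τ / a := by rw [le_div_iff₀ ha]; linarith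
    have h1 := Nat.floor_le (show 0 ≤ τ / a by linarith)
    have h2 := Nat.lt_floor_add_one (τ / a)
    have h3 : 4 ≤ ⌊τ / a⌋₊ := Nat.le_floor (by exact_mod_cast hr)
    refine ⟨⌊τ / a⌋₊ - 1, ?_, ?_⟩
    · rw [Nat.cast_sub (by omega)]
      rw [le_div_iff₀ ha] at h1
      push_cast; linarith
    · rw [Nat.cast_sub (by omega)]
      have : τ / (2 * a) = (τ / a) / 2 := by field_simp
      rw [this]; push_cast; linarith
  set S := strip Ω o n a with hS
  have hScomp : IsCompact S := strip_compact hcomp o n a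
  let r : ℕ → ℝ := fun j => 1 - (j + 1) * a / h
  let F : ℕ → Set E2 := fun j => AffineMap.homothety p (r j) '' S
  have hr : ∀ j < N, 1 / 2 ≤ r j ∧ r j < 1 := by
    intro j hj
    have hj' : (j : ℝ) + 1 ≤ N := by exact_mod_cast hj
    have : ((j : ℝ) + 1) * a ≤ h / 2 := by nlinarith
    constructor
    · simp only [r]
      have : ((j : ℝ) + 1) * a / h ≤ 1 / 2 := by
        rw [div_le_iff₀ hh0]; linarith
      linarith
    · simp only [r]
      have : 0 < ((j : ℝ) + 1) * a / h := by positivity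
      linarith
  have hrh : ∀ j, (1 - r j) * h = (j + 1) * a := by
    intro j; simp only [r]; field_simp; ring
  have hrange : ∀ j < N, ∀ x ∈ F j, ((j : ℝ) + 1) * a ≤ ⟪o - x, n⟫ ∧
      ⟪o - x, n⟫ < ((j : ℝ) + 2) * a := by
    rintro j hj _ ⟨y, hy, rfl⟩
    obtain ⟨h1, h2⟩ := hr j hj
    rw [height_homothety, ← hh, hrh]
    have h0 := hsup y hy.1
    have h3 := hy.2
    constructor
    · have := mul_nonneg (show 0 ≤ r j by linarith) h0
      linarith
    · have : r j * ⟪o - y, n⟫ < a := by nlinarith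
      linarith
  have hdisj : (↑(Finset.range N) : Set ℕ).PairwiseDisjoint F := by
    have key : ∀ i j, i < j → i < N → j < N → Disjoint (F i) (F j) := by
      intro i j hij hi hj
      rw [Set.disjoint_left]
      intro x hx hx'
      have h1 := (hrange i hi x hx).2
      have h2 := (hrange j hj x hx').1
      have : (i : ℝ) + 1 ≤ j := by exact_mod_cast hij
      nlinarith
    intro i hi j hj hij
    simp only [Finset.coe_range, Set.mem_Iio] at hi hj
    rcases lt_or_gt_of_ne hij with h | h
    · exact key i j h hi hj
    · exact (key j i h hj hi).symm
  have hmeas : ∀ j ∈ Finset.range N, MeasurableSet (F j) := by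
    intro j _
    have : IsCompact (F j) := hScomp.image (AffineMap.homothety_continuous p (r j))
    exact this.measurableSet
  have hsub : (⋃ j ∈ Finset.range N, F j) ⊆ strip Ω o n τ := by
    intro x hx
    simp only [Set.mem_iUnion, Finset.mem_range] at hx
    obtain ⟨j, hj, hx⟩ := hx
    have h1 := (hrange j hj x hx).2
    obtain ⟨h3, h4⟩ := hr j hj
    have hj' : (j : ℝ) + 1 ≤ N := by exact_mod_cast hj
    refine ⟨?_, by nlinarith⟩
    obtain ⟨y, hy, rfl⟩ := hx
    exact homothety_mem hconv hp hy.1 (by linarith) h4.le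
  have hfin : volume (strip Ω o n τ) ≠ ⊤ := (strip_compact hcomp o n τ).measure_lt_top.ne
  have hSfin : volume S ≠ ⊤ := hScomp.measure_lt_top.ne
  have hle := measure_mono (μ := volume) hsub
  rw [measure_biUnion_finset hdisj hmeas] at hle
  have hle2 := ENNReal.toReal_mono hfin hle
  have hFv : ∀ j, volume (F j) = ENNReal.ofReal ((r j) ^ 2) * volume S :=
    fun j => volume_homothety p (r j) S
  rw [ENNReal.toReal_sum (by
    intro j _; rw [hFv]; exact ENNReal.mul_ne_top ENNReal.ofReal_ne_top hSfin)] at hle2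
  refine le_trans ?_ hle2
  have hterm : ∀ j ∈ Finset.range N, 1 / 4 * (volume S).toReal ≤ (volume (F j)).toReal := by
    intro j hj
    obtain ⟨h1, h2⟩ := hr j (Finset.mem_range.1 hj)
    rw [hFv, ENNReal.toReal_mul, ENNReal.toReal_ofReal (sq_nonneg _)]
    apply mul_le_mul_of_nonneg_right _ ENNReal.toReal_nonneg
    nlinarith
  have hsum := Finset.sum_le_sum hterm
  rw [Finset.sum_const, Finset.card_range, nsmul_eq_mul] at hsum
  refine le_trans ?_ hsum
  have : τ / (8 * a) = τ / (2 * a) * (1 / 4) := by field_simp; ring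
  rw [this, mul_assoc]
  apply mul_le_mul_of_nonneg_right hN2
  positivity

/-- Supergradient inequality for concave functions. -/
theorem concave_supergrad {Ω : Set E2} {u : E2 → ℝ} (hu : ConcaveOn ℝ Ω u) {x y : E2}
    (hx : x ∈ Ω) (hy : y ∈ Ω) (hd : DifferentiableAt ℝ u x) :
    u y - u x ≤ ⟪gradient u x, y - x⟫ := by
  have h1 : HasDerivAt (fun s : ℝ => x + s • (y - x)) (y - x) 0 := by
    simpa using ((hasDerivAt_id (0 : ℝ)).smul_const (y - x)).const_add x
  have hg : HasFDerivAt u (fderiv ℝ u x) (x + (0 : ℝ) • (y - x)) := by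
    simpa using hd.hasFDerivAt
  have h2 : HasDerivAt (fun s : ℝ => u (x + s • (y - x))) (fderiv ℝ u x (y - x)) 0 :=
    hg.comp_hasDerivAt (0 : ℝ) h1
  have h3 : ⟪gradient u x, y - x⟫ = fderiv ℝ u x (y - x) := by
    simp [gradient]
  rw [h3]
  have h4 := h2.tendsto_slope_zero_right
  refine ge_of_tendsto h4 ?_
  have hmem : Ioo (0 : ℝ) 1 ∈ 𝓝[>] (0 : ℝ) := Ioo_mem_nhdsGT one_pos
  filter_upwards [hmem] with s hs
  have h5 := hu.2 hx hy (show 0 ≤ 1 - s by linarith [hs.2]) hs.1.le (by ring)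
  have h6 : (1 - s) • x + s • y = x + s • (y - x) := by module
  rw [h6] at h5
  simp only [smul_eq_mul, zero_add, zero_smul, add_zero] at h5 ⊢
  rw [inv_mul_eq_div, le_div_iff₀ hs.1]
  linarith

/-- Gradient bound from a lower bound on a ball. -/
theorem grad_bound {Ω : Set E2} {u : E2 → ℝ} (hu : ConcaveOn ℝ Ω u) {x : E2} {r m : ℝ}
    (hr : 0 < r) (hball : ∀ v : E2, ‖v‖ ≤ r → x + v ∈ Ω ∧ m ≤ u (x + v))
    (hd : DifferentiableAt ℝ u x) : ‖gradient u x‖ * r ≤ u x - m := by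
  have hx : x ∈ Ω := by simpa using (hball 0 (by simpa using hr.le)).1
  have hxm : m ≤ u x := by simpa using (hball 0 (by simpa using hr.le)).2
  set g := gradient u x with hg
  by_cases hg0 : g = 0
  · rw [hg0]; simp only [norm_zero, zero_mul]; linarith
  have hgn : 0 < ‖g‖ := norm_pos_iff.2 hg0
  obtain ⟨h1, h2⟩ := hball (-(r / ‖g‖) • g) (by
    rw [norm_smul, norm_neg, Real.norm_of_nonneg (by positivity), div_mul_cancel₀ _ hgn.ne'])
  have h3 := concave_supergrad hu hx h1 hd
  rw [← hg, add_sub_cancel_left, real_inner_smul_right, real_inner_self_eq_norm_sq] at h3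
  have h4 : -(r / ‖g‖) * ‖g‖ ^ 2 = -(‖g‖ * r) := by field_simp
  rw [h4] at h3
  linarith

/-- Near the supporting line, `u` is at most slightly above `u x₀`. -/
theorem usc_near {Ω : Set E2} (hcomp : IsCompact Ω) {o n : E2} (hnorm : ‖n‖ = 1)
    (hsup : ∀ x ∈ Ω, 0 ≤ ⟪o - x, n⟫) {u : E2 → ℝ} (husc : UpperSemicontinuousOn u Ω)
    (hmax : ∀ x ∈ {y : E2 | ⟪o - y, n⟫ = 0} ∩ frontier Ω, u x ≤ u o) {ε : ℝ} (hε : 0 < ε) :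
    ∃ δ > 0, ∀ y ∈ Ω, ⟪o - y, n⟫ ≤ δ → u y < u o + ε := by
  by_contra! hcon
  choose! y hyΩ hyT hyu using fun i : ℕ => hcon (1 / ((i : ℝ) + 1)) (by positivity)
  obtain ⟨q, hq, φ, hφ, hlim⟩ := hcomp.tendsto_subseq hyΩ
  have hT : ⟪o - q, n⟫ ≤ 0 := by
    have hc : Continuous fun z : E2 => ⟪o - z, n⟫ := by fun_prop
    have h1 := (hc.tendsto q).comp hlim
    have h2 := tendsto_one_div_add_atTop_nhds_zero_nat (𝕜 := ℝ)
    exact le_of_tendsto_of_tendsto' h1 (h2.comp hφ.tendsto_atTop) (fun i => hyT (φ i))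
  have hT0 : ⟪o - q, n⟫ = 0 := le_antisymm hT (hsup q hq)
  have hfr : q ∈ frontier Ω := by
    refine ⟨subset_closure hq, ?_⟩
    intro hint
    obtain ⟨r, hr, hball⟩ := Metric.isOpen_iff.1 isOpen_interior q hint
    have h1 : q + (r / 2) • n ∈ Ω := by
      apply interior_subset
      apply hball
      simp [norm_smul, hnorm, abs_of_pos hr, hr]
    have h2 := hsup _ h1
    have h3 : o - (q + (r / 2) • n) = (o - q) - (r / 2) • n := by abel
    rw [h3, inner_sub_left, hT0, real_inner_smul_left, real_inner_self_eq_norm_sq, hnorm] at h2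
    linarith
  have hle := hmax q ⟨hT0, hfr⟩
  have h4 := husc q hq (u o + ε) (by linarith)
  have h5 : Tendsto (y ∘ φ) atTop (𝓝[Ω] q) :=
    tendsto_nhdsWithin_iff.2 ⟨hlim, Eventually.of_forall fun i => hyΩ _⟩
  obtain ⟨i, hi⟩ := (h5.eventually h4).exists
  exact absurd (hyu (φ i)) (not_le.2 hi)

/-- Under Condition (B) and `z₀ = u(x₀) = max_{l ∩ ∂Ω} u > 0`, there exists a
family of convex bodies `Ω̃_k ⊆ Ω_k` (for all sufficiently large `k`) with
(i) `(1/k)·sup_{Ω̃_k} |∇u| → 0` as `k → +∞` and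
(ii) `(|Ω̃_k|/|Ω_k|)·k/(1+|∇u(x)|) ≥ c > 0` on `Ω̃_k` for large `k`. -/
theorem exists_good_family
    (Ω : Set E2) (hΩ : IsConvexBody Ω) (M : ℝ) (hM : 0 < M)
    (f : E2 → ℝ) (hfpos : ∀ x, 0 < f x) (hfcont : Continuous f) (hA : CondA f)
    (x₀ n : E2) (hx₀ : x₀ ∈ frontier Ω) (hB : CondB Ω x₀)
    (hn : IsSupportNormal Ω x₀ n)
    (u : E2 → ℝ) (hu : ConcaveOn ℝ Ω u) (hub : ∀ x ∈ Ω, u x ∈ Icc 0 M)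
    (husc : UpperSemicontinuousOn u Ω)
    (hz : 0 < u x₀)
    (hmax : ∀ x ∈ {y : E2 | ⟪x₀ - y, n⟫ = 0} ∩ frontier Ω, u x ≤ u x₀) :
    ∃ (Ωt : ℝ → Set E2) (K₀ : ℝ), 0 < K₀ ∧
      (∀ k ≥ K₀, IsConvexBody (Ωt k) ∧ Ωt k ⊆ Omk Ω u x₀ n k) ∧
      (∀ ε : ℝ, 0 < ε → ∃ K : ℝ, ∀ k ≥ K, ∀ x ∈ Ωt k,
        DifferentiableAt ℝ u x → ‖gradient u x‖ / k < ε) ∧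
      (∃ c : ℝ, 0 < c ∧ ∃ K : ℝ, ∀ k ≥ K, ∀ x ∈ Ωt k,
        DifferentiableAt ℝ u x →
          c ≤ (volume (Ωt k)).toReal / (volume (Omk Ω u x₀ n k)).toReal *
                (k / (1 + ‖gradient u x‖))) := by
  obtain ⟨hcomp, hconv, hint⟩ := hΩ
  obtain ⟨p, hpint⟩ := hint
  obtain ⟨hnorm, hsup⟩ := hn
  have hoΩ : x₀ ∈ Ω := hcomp.isClosed.frontier_subset hx₀
  have hpΩ : p ∈ Ω := interior_subset hpint
  have hto : ⟪x₀ - x₀, n⟫ = 0 := by simp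
  -- a ball around `p`
  obtain ⟨ρ, hρ, hball⟩ : ∃ ρ > 0, ∀ v : E2, ‖v‖ ≤ ρ → p + v ∈ Ω := by
    obtain ⟨r, hr, hb⟩ := Metric.isOpen_iff.1 isOpen_interior p hpint
    refine ⟨r / 2, by positivity, fun v hv => interior_subset (hb ?_)⟩
    simp only [Metric.mem_ball, dist_self_add_left]
    linarith
  set h := ⟪x₀ - p, n⟫ with hh
  have hh0 : 0 < h := by
    have h2 := hsup _ (hball (ρ • n) (by rw [norm_smul, hnorm, Real.norm_of_nonneg hρ.le]; simp))
    have h3 : x₀ - (p + ρ • n) = (x₀ - p) - ρ • n := by abel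
    rw [h3, inner_sub_left, real_inner_smul_left, real_inner_self_eq_norm_sq, hnorm] at h2
    linarith
  set z := u x₀ with hzdef
  set C := z / (2 * h) with hC
  have hC0 : 0 < C := by positivity
  let m : ℝ → ℝ := fun k => sSup (u '' strip Ω x₀ n (z / (2 * k)))
  let lam : ℝ → ℝ := fun k => max (m k - z) (C / k)
  let τ : ℝ → ℝ := fun k => z / (4 * (lam k * k))
  have hm : ∀ k, ∀ y ∈ Ω, ⟪x₀ - y, n⟫ ≤ z / (2 * k) → u y ≤ m k := by
    intro k y hy hT
    apply le_csSup
    · exact ⟨M, by rintro _ ⟨w, hw, rfl⟩; exact (hub w hw.1).2⟩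
    · exact ⟨y, ⟨hy, hT⟩, rfl⟩
  have hlam : ∀ ε : ℝ, 0 < ε → ∃ K : ℝ, 0 < K ∧ ∀ k ≥ K, lam k ≤ ε := by
    intro ε hε
    obtain ⟨δ, hδ, hδu⟩ := usc_near hcomp hnorm hsup husc hmax hε
    refine ⟨max (z / (2 * δ)) (C / ε), lt_max_of_lt_right (by positivity), fun k hk => ?_⟩
    have hk1 := (le_max_left _ _).trans hk
    have hk2 := (le_max_right _ _).trans hk
    have hk0 : 0 < k := lt_of_lt_of_le (by positivity) hk2
    apply max_le
    · have : m k ≤ z + ε := by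
        apply csSup_le
        · exact ⟨_, x₀, ⟨hoΩ, by rw [hto]; positivity⟩, rfl⟩
        · rintro _ ⟨y, hy, rfl⟩
          refine (hδu y hy.1 (hy.2.trans ?_)).le
          rw [div_le_iff₀ (by positivity)] at hk1 ⊢
          linarith
      linarith
    · rw [div_le_iff₀ (by positivity)] at hk2 ⊢
      linarith
  obtain ⟨K₀, hK₀, hK₀l⟩ := hlam (min (1 / 2) (z / (16 * M))) (by positivity)
  have hpos : ∀ k ≥ K₀, 0 < k := fun k hk => lt_of_lt_of_le hK₀ hk
  have hlp : ∀ k ≥ K₀, 0 < lam k := fun k hk =>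
    lt_of_lt_of_le (div_pos hC0 (hpos k hk)) (le_max_right _ _)
  have hlC : ∀ k ≥ K₀, C ≤ lam k * k := fun k hk => by
    rw [← div_le_iff₀ (hpos k hk)]; exact le_max_right _ _
  have hl1 : ∀ k ≥ K₀, lam k ≤ 1 / 2 := fun k hk => (hK₀l k hk).trans (min_le_left _ _)
  have hl2 : ∀ k ≥ K₀, lam k ≤ z / (16 * M) := fun k hk => (hK₀l k hk).trans (min_le_right _ _)
  have hτ0 : ∀ k ≥ K₀, 0 < τ k := fun k hk => by
    have := hlp k hk; have := hpos k hk
    simp only [τ]; positivity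
  have hτh : ∀ k ≥ K₀, τ k ≤ h / 2 := fun k hk => by
    have h1 := hlC k hk
    have h2 := hlp k hk; have h3 := hpos k hk
    simp only [τ]
    rw [hC, div_le_iff₀ (by positivity)] at h1
    rw [div_le_iff₀ (by positivity)]
    linarith
  have hτl : ∀ k ≥ K₀, lam k * τ k = z / (4 * k) := fun k hk => by
    have h2 := hlp k hk; have h3 := hpos k hk
    simp only [τ]; field_simp
  have hμ : ∀ k ≥ K₀, 0 < τ k / h ∧ τ k / h ≤ 1 / 2 := fun k hk => by
    refine ⟨div_pos (hτ0 k hk) hh0, ?_⟩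
    rw [div_le_iff₀ hh0]; linarith [hτh k hk]
  let Ωt : ℝ → Set E2 := fun k => AffineMap.homothety x₀ (lam k) ''
    (AffineMap.homothety p (1 - τ k / h) '' strip Ω x₀ n (τ k))
  -- lower bound on `u` on the shrunken copy of `Ω`
  have hlow : ∀ k ≥ K₀, ∀ y ∈ Ω, AffineMap.homothety x₀ (lam k) y ∈ Ω ∧
      (1 - lam k) * z ≤ u (AffineMap.homothety x₀ (lam k) y) := by
    intro k hk y hy
    have h1 := hl1 k hk; have h2 := hlp k hk
    refine ⟨homothety_mem hconv hoΩ hy h2.le (by linarith), ?_⟩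
    have h3 := hu.2 hoΩ hy (show 0 ≤ 1 - lam k by linarith) h2.le (by ring)
    have h4 : AffineMap.homothety x₀ (lam k) y = (1 - lam k) • x₀ + lam k • y := by
      rw [AffineMap.homothety_apply]; simp only [vsub_eq_sub, vadd_eq_add]; module
    rw [h4]
    have h5 := mul_nonneg h2.le (hub y hy).1
    simp only [smul_eq_mul] at h3
    linarith
  -- heights on `Ωt k`
  have hheight : ∀ k ≥ K₀, ∀ x ∈ Ωt k, ⟪x₀ - x, n⟫ ≤ z / (2 * k) := by
    rintro k hk _ ⟨_, ⟨y, hy, rfl⟩, rfl⟩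
    obtain ⟨h1, h2⟩ := hμ k hk
    rw [height_homothety, height_homothety, hto, ← hh]
    have h3 : (1 - (1 - τ k / h)) * h = τ k := by field_simp; ring
    rw [h3]
    have h4 : (1 - τ k / h) * ⟪x₀ - y, n⟫ ≤ τ k := by
      have := hsup y hy.1
      have := hy.2
      nlinarith
    have h5 := mul_le_mul_of_nonneg_left h4 (hlp k hk).le
    have h6 := hτl k hk
    have h7 : z / (2 * k) = 2 * (z / (4 * k)) := by have := hpos k hk; field_simp; ring
    rw [h7, ← h6]
    linarith
  have hstr : ∀ k ≥ K₀, ∀ y ∈ strip Ω x₀ n (τ k), AffineMap.homothety p (1 - τ k / h) y ∈ Ω := by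
    intro k hk y hy
    obtain ⟨h1, h2⟩ := hμ k hk
    exact homothety_mem hconv hpΩ hy.1 (by linarith) (by linarith)
  have hsubset : ∀ k ≥ K₀, Ωt k ⊆ Omk Ω u x₀ n k := by
    intro k hk x hx
    have hT := hheight k hk x hx
    obtain ⟨_, ⟨y, hy, rfl⟩, rfl⟩ := hx
    obtain ⟨h1, h2⟩ := hlow k hk _ (hstr k hk y hy)
    refine ⟨h1, ?_⟩
    have h3 := mul_le_mul_of_nonneg_left hT (hpos k hk).le
    have h4 : k * (z / (2 * k)) = z / 2 := by have := hpos k hk; field_simp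
    rw [h4] at h3
    have h5 := hl1 k hk
    nlinarith
  have hbody : ∀ k ≥ K₀, IsConvexBody (Ωt k) := by
    intro k hk
    obtain ⟨h1, h2⟩ := hμ k hk
    refine ⟨((strip_compact hcomp x₀ n _).image (AffineMap.homothety_continuous _ _)).image
      (AffineMap.homothety_continuous _ _),
      ((strip_convex hconv x₀ n _).affine_image _).affine_image _, ?_⟩
    have ho1 := AffineMap.homothety_isOpenMap (R := ℝ) x₀ (lam k) (hlp k hk).ne'
    have ho2 := AffineMap.homothety_isOpenMap (R := ℝ) p (1 - τ k / h) (by linarith)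
    have hne : (interior (strip Ω x₀ n (τ k))).Nonempty := by
      have hr0 : 0 < τ k / h / 2 := by linarith
      refine ⟨AffineMap.homothety x₀ (τ k / h / 2) p, ?_⟩
      have hopen : IsOpen ((AffineMap.homothety x₀ (τ k / h / 2) '' interior Ω) ∩
          {y : E2 | ⟪x₀ - y, n⟫ < τ k}) :=
        ((AffineMap.homothety_isOpenMap (R := ℝ) x₀ _ hr0.ne') _ isOpen_interior).inter
          (isOpen_lt (by fun_prop) (by fun_prop))
      refine interior_maximal ?_ hopen ⟨⟨p, hpint, rfl⟩, ?_⟩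
      · rintro _ ⟨⟨y, hy, rfl⟩, hT⟩
        exact ⟨homothety_mem hconv hoΩ (interior_subset hy) hr0.le (by linarith), le_of_lt hT⟩
      · simp only [Set.mem_setOf_eq]
        rw [height_homothety, hto, ← hh]
        have : τ k / h / 2 * h = τ k / 2 := by field_simp
        rw [this]
        linarith [hτ0 k hk]
    exact ((hne.image _).image _).mono (interior_maximal
      (Set.image_mono (Set.image_mono interior_subset)) (ho1 _ (ho2 _ isOpen_interior)))
  set D := (1 + z) * (4 * h) / (z * ρ) with hD
  have hD0 : 0 < D := by positivity
  have hgrad : ∀ k ≥ K₀, ∀ x ∈ Ωt k, DifferentiableAt ℝ u x →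
      ‖gradient u x‖ ≤ D * (lam k * k) := by
    intro k hk x hx hd
    have hk0 := hpos k hk
    have hl0 := hlp k hk
    obtain ⟨hμ1, hμ2⟩ := hμ k hk
    have hxm : u x ≤ m k := hm k x (hsubset k hk hx).1 (hheight k hk x hx)
    have hml : m k - z ≤ lam k := le_max_left _ _
    have hrr : lam k * (τ k / h) * ρ = z * ρ / (4 * h * k) := by
      rw [← mul_div_assoc, hτl k hk]; field_simp
    have hb := grad_bound hu (x := x) (r := lam k * (τ k / h) * ρ) (m := (1 - lam k) * z)
      (by positivity) (by
        intro v hv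
        obtain ⟨_, ⟨y, hy, rfl⟩, rfl⟩ := hx
        have hl0' := hl0.ne'
        have hμ1' := hμ1.ne'
        have hv' : ‖(lam k * (τ k / h))⁻¹ • v‖ ≤ ρ := by
          rw [norm_smul, Real.norm_of_nonneg (by positivity), inv_mul_le_iff₀ (by positivity)]
          exact hv
        have hw := hball _ hv'
        set w := p + (lam k * (τ k / h))⁻¹ • v with hwdef
        have hin : AffineMap.homothety w (1 - τ k / h) y ∈ Ω :=
          homothety_mem hconv hw hy.1 (by linarith) (by linarith)
        have heq : AffineMap.homothety x₀ (lam k) (AffineMap.homothety p (1 - τ k / h) y) + v =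
            AffineMap.homothety x₀ (lam k) (AffineMap.homothety w (1 - τ k / h) y) := by
          have hvv : v = (lam k * (τ k / h)) • ((lam k * (τ k / h))⁻¹ • v) := by
            rw [smul_smul, mul_inv_cancel₀ (mul_ne_zero hl0' hμ1'), one_smul]
          rw [hwdef]
          generalize (lam k * (τ k / h))⁻¹ • v = v' at hvv
          rw [hvv]
          simp only [AffineMap.homothety_apply, vsub_eq_sub, vadd_eq_add]
          generalize τ k / h = μ
          module
        rw [heq]
        exact hlow k hk _ hin) hd
    rw [hrr] at hb
    have hb2 : ‖gradient u x‖ * (z * ρ / (4 * h * k)) ≤ lam k * (1 + z) := by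
      refine hb.trans ?_
      nlinarith
    have : D * (lam k * k) = lam k * (1 + z) / (z * ρ / (4 * h * k)) := by
      rw [hD]; field_simp
    rw [this, le_div_iff₀ (by positivity)]
    exact hb2
  refine ⟨Ωt, K₀, hK₀, fun k hk => ⟨hbody k hk, hsubset k hk⟩, ?_, ?_⟩
  · intro ε hε
    obtain ⟨K, hK, hKl⟩ := hlam (ε / (2 * D)) (by positivity)
    refine ⟨max K K₀, fun k hk x hx hd => ?_⟩
    have hk1 := (le_max_left _ _).trans hk
    have hk2 := (le_max_right _ _).trans hk
    have hk0 := hpos k hk2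
    have h1 := hgrad k hk2 x hx hd
    have h2 := hKl k hk1
    rw [div_lt_iff₀ hk0]
    rw [le_div_iff₀ (by positivity)] at h2
    nlinarith
  · refine ⟨z / (128 * M) / (1 / C + D), by positivity, K₀, fun k hk x hx hd => ?_⟩
    have hk0 := hpos k hk
    have hl0 := hlp k hk
    obtain ⟨hμ1, hμ2⟩ := hμ k hk
    have hg := hgrad k hk x hx hd
    have hOsub : Omk Ω u x₀ n k ⊆ strip Ω x₀ n (M / k) := by
      intro y hy
      refine ⟨hy.1, ?_⟩
      rw [le_div_iff₀ hk0]
      have h1 := hy.2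
      have h2 := (hub y hy.1).2
      linarith
    have hafin : volume (strip Ω x₀ n (M / k)) ≠ ⊤ :=
      (strip_compact hcomp x₀ n _).measure_lt_top.ne
    have hWle := ENNReal.toReal_mono hafin (measure_mono (μ := volume) hOsub)
    have hOfin : volume (Omk Ω u x₀ n k) ≠ ⊤ := ne_top_of_le_ne_top hafin (measure_mono hOsub)
    have hVpos : 0 < volume (Ωt k) := Measure.measure_pos_of_nonempty_interior _ (hbody k hk).2.2
    have hWpos : 0 < (volume (Omk Ω u x₀ n k)).toReal :=
      ENNReal.toReal_pos (hVpos.trans_le (measure_mono (hsubset k hk))).ne' hOfin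
    have hgrow := strip_growth hcomp hconv hsup hpΩ (a := M / k) (τ := τ k) (by positivity)
      (by
        have h2 := hl2 k hk
        have h3 := hτl k hk
        rw [le_div_iff₀ (by positivity)] at h2
        simp only [τ]
        rw [le_div_iff₀ (by positivity)]
        have : 4 * (M / k) * (4 * (lam k * k)) = lam k * (16 * M) := by field_simp; ring
        rw [this]; exact h2) (hτh k hk)
    have hV : (volume (Ωt k)).toReal =
        lam k ^ 2 * ((1 - τ k / h) ^ 2 * (volume (strip Ω x₀ n (τ k))).toReal) := by
      simp only [Ωt]
      rw [volume_homothety, volume_homothety, ENNReal.toReal_mul, ENNReal.toReal_mul,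
        ENNReal.toReal_ofReal (sq_nonneg _), ENNReal.toReal_ofReal (sq_nonneg _)]
    have hτa : τ k / (8 * (M / k)) = z / (32 * M * lam k) := by
      simp only [τ]; field_simp; ring
    rw [hτa] at hgrow
    have hVge : lam k * (z / (128 * M)) * (volume (Omk Ω u x₀ n k)).toReal ≤
        (volume (Ωt k)).toReal := by
      rw [hV]
      have h1 : 1 / 4 ≤ (1 - τ k / h) ^ 2 := by nlinarith
      calc lam k * (z / (128 * M)) * (volume (Omk Ω u x₀ n k)).toReal
          ≤ lam k * (z / (128 * M)) * (volume (strip Ω x₀ n (M / k))).toReal := by gcongr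
        _ = lam k ^ 2 * (1 / 4 * (z / (32 * M * lam k) *
              (volume (strip Ω x₀ n (M / k))).toReal)) := by field_simp; ring
        _ ≤ _ := by gcongr
    have h1g : 1 + ‖gradient u x‖ ≤ (1 / C + D) * (lam k * k) := by
      have h1 : 1 ≤ 1 / C * (lam k * k) := by
        rw [one_div, le_inv_mul_iff₀ hC0]; linarith [hlC k hk]
      linarith
    have hgp : 0 < 1 + ‖gradient u x‖ := by positivity
    calc z / (128 * M) / (1 / C + D)
        = lam k * (z / (128 * M)) * (k / ((1 / C + D) * (lam k * k))) := by
          have : 0 < 1 / C + D := by positivity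
          generalize 1 / C + D = E at this
          field_simp
      _ ≤ _ := by
          apply mul_le_mul
          · rw [le_div_iff₀ hWpos]; exact hVge
          · gcongr
          · positivity
          · positivity
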